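/- arXiv:0704.3511 — 2 statements merged into one kernel-verified Lean document; each statement's English description precedes it below -/
import Mathlib

section
/- Let U ⊆ M be a saturated open set and H : U × [0,1] → M a foliated homotopy. Then U is saturated for the partition E by leaf closures (it contains cl(L) for each leaf L ⊆ U), and H is E-foliated: for each t ∈ [0,1] and each leaf L ⊆ U, H_t(cl(L)) is contained in a single E-class cl(L'). Moreover, if H(·,1) has image in a single leaf L₀, or more generally in a minimal set K, then H(·,1) has image contained in the single E-class cl(L₀) (respectively, in K, which equals the closure of each leaf it contains). -/
/-- The leaf through `x` of the partition determined by the equivalence relation `r`. -/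
def leaf {M : Type*} (r : M → M → Prop) (x : M) : Set M := {y | r x y}

/-- A set is saturated if it is a union of leaves. -/
def Saturated {M : Type*} (r : M → M → Prop) (U : Set M) : Prop :=
  ∀ x ∈ U, leaf r x ⊆ U

/-- A foliated homotopy on a saturated open set `U`: a continuous map
`H : U × [0,1] → M` with `H(x,0) = x`, such that for each `t` the map `H_t`
sends (the trace on `U` of) each leaf into a single leaf. -/
def FoliatedHomotopy {M : Type*} [TopologicalSpace M] (r : M → M → Prop)
    (U : Set M) (H : M × ℝ → M) : Prop :=
  ContinuousOn H (U ×ˢ Set.Icc (0:ℝ) 1) ∧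
  (∀ x ∈ U, H (x, 0) = x) ∧
  ∀ t ∈ Set.Icc (0:ℝ) 1, ∀ x ∈ U, ∀ y ∈ U, r x y → r (H (x, t)) (H (y, t))

/-- A minimal set: a nonempty closed saturated set containing no proper nonempty
closed saturated subset. -/
def MinimalSet {M : Type*} [TopologicalSpace M] (r : M → M → Prop) (K : Set M) : Prop :=
  K.Nonempty ∧ IsClosed K ∧ Saturated r K ∧
    ∀ K' ⊆ K, K'.Nonempty → IsClosed K' → Saturated r K' → K' = K

/-- When the leaf closures are minimal, a saturated open set contains the closure of each of its
leaves. -/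
theorem Saturated.closure_leaf_subset {M : Type*} [TopologicalSpace M] {r : M → M → Prop}
    (hr : Equivalence r) (hclosSat : ∀ x : M, Saturated r (closure (leaf r x)))
    (hminimal : ∀ x y : M, leaf r y ⊆ closure (leaf r x) →
      closure (leaf r y) = closure (leaf r x))
    {U : Set M} (hUopen : IsOpen U) (hUsat : Saturated r U) {x : M} (hx : x ∈ U) :
    closure (leaf r x) ⊆ U := by
  intro y hy
  have hxy : x ∈ closure (leaf r y) := by
    rw [hminimal x y (hclosSat x y hy)]
    exact subset_closure (hr.refl x)
  obtain ⟨w, hwU, hyw⟩ := mem_closure_iff.1 hxy U hUopen hx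
  exact hUsat w hwU (hr.symm hyw)

/-- A foliated homotopy maps leaf closures contained in its domain into leaf closures. -/
theorem FoliatedHomotopy.mem_closure_leaf {M : Type*} [TopologicalSpace M] {r : M → M → Prop}
    {U : Set M} {H : M × ℝ → M} (hH : FoliatedHomotopy r U H) (hUsat : Saturated r U)
    {t : ℝ} (ht : t ∈ Set.Icc (0 : ℝ) 1) {x y : M} (hx : x ∈ U) (hyU : y ∈ U)
    (hy : y ∈ closure (leaf r x)) : H (y, t) ∈ closure (leaf r (H (x, t))) := by
  have hcont : ContinuousOn (fun z => H (z, t)) U :=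
    hH.1.comp (by fun_prop) fun z hz => ⟨hz, ht⟩
  exact ((hcont y hyU).mono (hUsat x hx)).mem_closure hy
    fun z hz => hH.2.2 t ht x hx z (hUsat x hx hz) hz

/-- A minimal set is the closure of each leaf it contains, provided leaf closures are saturated. -/
theorem MinimalSet.eq_closure_leaf {M : Type*} [TopologicalSpace M] {r : M → M → Prop}
    (hr : Equivalence r) (hclosSat : ∀ x : M, Saturated r (closure (leaf r x)))
    {K : Set M} (hK : MinimalSet r K) {z : M} (hz : z ∈ K) : K = closure (leaf r z) :=
  (hK.2.2.2 _ (closure_minimal (hK.2.2.1 z hz) hK.2.1) ⟨z, subset_closure (hr.refl z)⟩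
    isClosed_closure (hclosSat z)).symm

/-- A foliated homotopy on a saturated open set descends to the partition by leaf
closures: `U` is saturated for leaf closures, `H` is foliated for leaf closures, and
if `H(·,1)` has image in a single leaf (resp. a minimal set `K`), then it has image
in the corresponding leaf-closure class (resp. in `K`, which is the closure of each
leaf it contains). -/
theorem stmt1 {M : Type*} [TopologicalSpace M] (r : M → M → Prop) (hr : Equivalence r)
    (hclosSat : ∀ x : M, Saturated r (closure (leaf r x)))
    (hminimal : ∀ x y : M, leaf r y ⊆ closure (leaf r x) →
      closure (leaf r y) = closure (leaf r x))
    (U : Set M) (hUopen : IsOpen U) (hUsat : Saturated r U)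
    (H : M × ℝ → M) (hH : FoliatedHomotopy r U H) :
    (∀ x ∈ U, closure (leaf r x) ⊆ U) ∧
    (∀ t ∈ Set.Icc (0:ℝ) 1, ∀ x ∈ U, ∀ y ∈ closure (leaf r x),
      H (y, t) ∈ closure (leaf r (H (x, t)))) ∧
    (∀ x₀ : M, (∀ x ∈ U, H (x, 1) ∈ leaf r x₀) →
      ∀ x ∈ U, H (x, 1) ∈ closure (leaf r x₀)) ∧
    (∀ K : Set M, MinimalSet r K → (∀ x ∈ U, H (x, 1) ∈ K) →
      (∀ x ∈ U, H (x, 1) ∈ K) ∧ ∀ z ∈ K, K = closure (leaf r z)) := by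
  have hUclos : ∀ x ∈ U, closure (leaf r x) ⊆ U := fun x hx =>
    hUsat.closure_leaf_subset hr hclosSat hminimal hUopen hx
  exact ⟨hUclos, fun t ht x hx y hy => hH.mem_closure_leaf hUsat ht hx (hUclos x hx hy) hy,
    fun x₀ h x hx => subset_closure (h x hx),
    fun K hK h => ⟨h, fun z hz => hK.eq_closure_leaf hr hclosSat hz⟩⟩
end

section
/- With the transverse categories defined below, cat(M,E) ≤ cat^e(M,F) ≤ cat(M,F), where F denotes the given partition into leaves and E the induced partition by leaf closures. -/
/-- A set saturated for the partition `E` by leaf closures. -/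
def ESaturated {M : Type*} [TopologicalSpace M] (r : M → M → Prop) (U : Set M) : Prop :=
  ∀ x ∈ U, closure (leaf r x) ⊆ U

/-- An `E`-foliated homotopy for the partition by leaf closures. -/
def EFoliatedHomotopy {M : Type*} [TopologicalSpace M] (r : M → M → Prop)
    (U : Set M) (H : M × ℝ → M) : Prop :=
  ContinuousOn H (U ×ˢ Set.Icc (0:ℝ) 1) ∧
  (∀ x ∈ U, H (x, 0) = x) ∧
  ∀ t ∈ Set.Icc (0:ℝ) 1, ∀ x ∈ U, ∀ y ∈ U, y ∈ closure (leaf r x) →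
    H (y, t) ∈ closure (leaf r (H (x, t)))

/-- `M` admits a cover by `k` transversely categorical saturated open sets:
each set carries a foliated homotopy ending in a single leaf. -/
def CoverF {M : Type*} [TopologicalSpace M] (r : M → M → Prop) (k : ℕ) : Prop :=
  ∃ Us : Fin k → Set M, (⋃ i, Us i) = Set.univ ∧
    ∀ i, IsOpen (Us i) ∧ Saturated r (Us i) ∧
      ∃ H : M × ℝ → M, FoliatedHomotopy r (Us i) H ∧
        ∃ x₀ : M, ∀ x ∈ Us i, H (x, 1) ∈ leaf r x₀

/-- `M` admits a cover by `k` essentially transversely categorical saturated open sets: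
each set carries a foliated homotopy ending in a minimal set. -/
def CoverEss {M : Type*} [TopologicalSpace M] (r : M → M → Prop) (k : ℕ) : Prop :=
  ∃ Us : Fin k → Set M, (⋃ i, Us i) = Set.univ ∧
    ∀ i, IsOpen (Us i) ∧ Saturated r (Us i) ∧
      ∃ H : M × ℝ → M, FoliatedHomotopy r (Us i) H ∧
        ∃ K : Set M, MinimalSet r K ∧ ∀ x ∈ Us i, H (x, 1) ∈ K

/-- `M` admits a cover by `k` transversely categorical open sets for the partition `E`
by leaf closures: each set is `E`-saturated, open, and carries an `E`-foliated homotopy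
ending in a single `E`-class. -/
def CoverE {M : Type*} [TopologicalSpace M] (r : M → M → Prop) (k : ℕ) : Prop :=
  ∃ Us : Fin k → Set M, (⋃ i, Us i) = Set.univ ∧
    ∀ i, IsOpen (Us i) ∧ ESaturated r (Us i) ∧
      ∃ H : M × ℝ → M, EFoliatedHomotopy r (Us i) H ∧
        ∃ x₀ : M, ∀ x ∈ Us i, H (x, 1) ∈ closure (leaf r x₀)

/-- The least `k` (in `ℕ∞`) for which a cover of the given kind exists; `∞` if none. -/
noncomputable def catNum (P : ℕ → Prop) : ℕ∞ :=
  sInf {n : ℕ∞ | ∃ k : ℕ, (k : ℕ∞) = n ∧ P k}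

theorem catNum_mono {P Q : ℕ → Prop} (h : ∀ k, Q k → P k) : catNum P ≤ catNum Q :=
  sInf_le_sInf fun _ ⟨k, hk, hQ⟩ => ⟨k, hk, h k hQ⟩

theorem closure_leaf_subset {M : Type*} [TopologicalSpace M] {r : M → M → Prop} {K : Set M}
    (hK : IsClosed K) (hsat : Saturated r K) {x : M} (hx : x ∈ K) : closure (leaf r x) ⊆ K :=
  closure_minimal (hsat x hx) hK

/-- If `closure (leaf r y) = closure (leaf r x)` whenever `y ∈ closure (leaf r x)`, every open
saturated set is saturated by leaf closures. -/
theorem Saturated.eSaturated {M : Type*} [TopologicalSpace M] {r : M → M → Prop}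
    (hr : Equivalence r)
    (hE : ∀ x, ∀ y ∈ closure (leaf r x), closure (leaf r y) = closure (leaf r x))
    {U : Set M} (hU : IsOpen U) (hsat : Saturated r U) : ESaturated r U := by
  intro x hx y hy
  have hxy : x ∈ closure (leaf r y) := by
    rw [hE x y hy]
    exact subset_closure (hr.refl x)
  obtain ⟨z, hzU, hyz⟩ := mem_closure_iff.1 hxy U hU hx
  exact hsat z hzU (hr.symm hyz)

/-- By continuity, a foliated homotopy sends leaf closures into leaf closures. -/
theorem FoliatedHomotopy.eFoliatedHomotopy {M : Type*} [TopologicalSpace M]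
    {r : M → M → Prop} {U : Set M} (hsat : Saturated r U) {H : M × ℝ → M}
    (hH : FoliatedHomotopy r U H) : EFoliatedHomotopy r U H := by
  obtain ⟨hcont, hzero, hleaf⟩ := hH
  refine ⟨hcont, hzero, fun t ht x hx y hy hyx => ?_⟩
  have hslice : ContinuousOn (fun z => H (z, t)) U :=
    hcont.comp (Continuous.prodMk_left t).continuousOn fun z hz => ⟨hz, ht⟩
  exact ((hslice y hy).mono (hsat x hx)).mem_closure hyx
    fun z hz => hleaf t ht x hx z (hsat x hx hz) hz

theorem minimalSet_closure_leaf {M : Type*} [TopologicalSpace M] {r : M → M → Prop}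
    (hr : Equivalence r)
    (hE : ∀ x, ∀ y ∈ closure (leaf r x), closure (leaf r y) = closure (leaf r x))
    {x : M} (hsat : Saturated r (closure (leaf r x))) : MinimalSet r (closure (leaf r x)) := by
  refine ⟨⟨x, subset_closure (hr.refl x)⟩, isClosed_closure, hsat, ?_⟩
  rintro K hK ⟨y, hy⟩ hKclosed hKsat
  refine hK.antisymm ?_
  rw [← hE x y (hK hy)]
  exact closure_leaf_subset hKclosed hKsat hy

theorem MinimalSet.exists_eq_closure_leaf {M : Type*} [TopologicalSpace M]
    {r : M → M → Prop} (hr : Equivalence r)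
    (hclosSat : ∀ x : M, Saturated r (closure (leaf r x)))
    {K : Set M} (hK : MinimalSet r K) : ∃ x, closure (leaf r x) = K := by
  obtain ⟨⟨x, hx⟩, hclosed, hsat, hmin⟩ := hK
  exact ⟨x, hmin _ (closure_leaf_subset hclosed hsat hx) ⟨x, subset_closure (hr.refl x)⟩
    isClosed_closure (hclosSat x)⟩

/-- `cat(M,E) ≤ cat^e(M,F) ≤ cat(M,F)`. -/
theorem stmt2 {M : Type*} [TopologicalSpace M] (r : M → M → Prop) (hr : Equivalence r)
    (hclosSat : ∀ x : M, Saturated r (closure (leaf r x)))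
    (hminimal : ∀ x y : M, leaf r y ⊆ closure (leaf r x) →
      closure (leaf r y) = closure (leaf r x)) :
    catNum (CoverE r) ≤ catNum (CoverEss r) ∧
    catNum (CoverEss r) ≤ catNum (CoverF r) := by
  have hE : ∀ x, ∀ y ∈ closure (leaf r x), closure (leaf r y) = closure (leaf r x) :=
    fun x y hy => hminimal x y (hclosSat x y hy)
  refine ⟨catNum_mono ?_, catNum_mono ?_⟩
  · rintro k ⟨Us, hcover, hUs⟩
    refine ⟨Us, hcover, fun i => ?_⟩
    obtain ⟨hopen, hsat, H, hH, K, hK, hend⟩ := hUs i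
    obtain ⟨x₀, rfl⟩ := hK.exists_eq_closure_leaf hr hclosSat
    exact ⟨hopen, hsat.eSaturated hr hE hopen, H, hH.eFoliatedHomotopy hsat, x₀, hend⟩
  · rintro k ⟨Us, hcover, hUs⟩
    refine ⟨Us, hcover, fun i => ?_⟩
    obtain ⟨hopen, hsat, H, hH, x₀, hend⟩ := hUs i
    exact ⟨hopen, hsat, H, hH, closure (leaf r x₀), minimalSet_closure_leaf hr hE (hclosSat x₀),
      fun x hx => subset_closure (hend x hx)⟩
end
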